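/- For every integer d ≥ 1, every p₀ ∈ (0, 1/2], and every γ > 0 there exists n₀ depending only on d, p₀ and γ such that the following holds for all n ≥ n₀ and all p ∈ [p₀, 1/2) with pn an integer. Let f be a multilinear polynomial of degree at most d on n variables all of whose coefficients are integer multiples of γ, and suppose Var_{D_p}(f) < n^{1/2}. Then there exists a multilinear polynomial h of degree at most d−1 such that the multilinear expansion of f − (Σ_{i=1}^n x_i − (1−2p)n)·h has at most (20·d²·7^d·(d!)^{2d²}/(2p)^{4d}) · Var_{D_p}(f)/γ² active variables. -/

import Mathlib

open Finset

/-- Evaluation of a multilinear polynomial given its coefficients. -/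
noncomputable def evalML {n : ℕ} (c : Finset (Fin n) → ℝ) (x : Fin n → ℝ) : ℝ :=
  ∑ S : Finset (Fin n), c S * ∏ i ∈ S, x i

/-- The ±1 assignment corresponding to a Boolean assignment. -/
def signs {n : ℕ} (σ : Fin n → Bool) : Fin n → ℝ := fun i => if σ i then 1 else -1

/-- The (integer) sum of the ±1 values of an assignment. -/
def intSum {n : ℕ} (σ : Fin n → Bool) : ℤ := ∑ i, (if σ i then (1 : ℤ) else -1)

/-- The set of assignments satisfying `∑ i x i = (1-2p) n`, where `k = p n`. -/
def cardSet (n k : ℕ) : Finset (Fin n → Bool) :=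
  Finset.univ.filter fun σ => intSum σ = (n : ℤ) - 2 * k

/-- Expectation of `g` over the uniform distribution on `A`. -/
noncomputable def expOver {n : ℕ} (A : Finset (Fin n → Bool)) (g : (Fin n → Bool) → ℝ) : ℝ :=
  (∑ σ ∈ A, g σ) / A.card

/-- Variance of `g` under the uniform distribution on `A`. -/
noncomputable def varOver {n : ℕ} (A : Finset (Fin n → Bool)) (g : (Fin n → Bool) → ℝ) : ℝ :=
  expOver A (fun σ => g σ ^ 2) - (expOver A g) ^ 2

/-- Coefficient at `T` of the multilinear expansion of `(∑ i, x i) * h` (using `x i ^ 2 = 1`). -/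
noncomputable def mulSum {n : ℕ} (h : Finset (Fin n) → ℝ) (T : Finset (Fin n)) : ℝ :=
  ∑ i : Fin n, h (symmDiff T {i})


/-- The character `∏ i ∈ S, x i` as a function on the cube. -/
def chi {ι : Type*} (S : Finset ι) : (ι → Bool) → ℝ :=
  fun σ => ∏ i ∈ S, if σ i then (1 : ℝ) else -1

/-- Functions on the cube spanned by the characters of subsets of `U` of size less than `m`. -/
def lowDeg {ι : Type*} (U : Finset ι) (m : ℕ) : Submodule ℝ ((ι → Bool) → ℝ) :=
  Submodule.span ℝ (chi '' {S | S ⊆ U ∧ S.card < m})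

/-- The action of a permutation of the coordinates on functions on the cube. -/
def permute {ι : Type*} (π : Equiv.Perm ι) : ((ι → Bool) → ℝ) →ₗ[ℝ] ((ι → Bool) → ℝ) :=
  LinearMap.funLeft ℝ ℝ (fun σ => σ ∘ π)

/-- The affine function `∑ i ∈ U, x i - s`. -/
noncomputable def sliceForm {ι : Type*} (U : Finset ι) (s : ℝ) : (ι → Bool) → ℝ :=
  ∑ i ∈ U, chi {i} - fun _ => s

/-- The multiples of `sliceForm U s` by functions in `lowDeg U m`. -/
noncomputable def sliceIdeal {ι : Type*} (U : Finset ι) (s : ℝ) (m : ℕ) :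
    Submodule ℝ ((ι → Bool) → ℝ) :=
  (lowDeg U m).map (LinearMap.mulLeft ℝ (sliceForm U s))

section Cube

variable {ι : Type*}

theorem chi_mem_lowDeg {U S : Finset ι} {m : ℕ} (hS : S ⊆ U) (hm : S.card < m) :
    chi S ∈ lowDeg U m :=
  Submodule.subset_span ⟨S, ⟨hS, hm⟩, rfl⟩

theorem lowDeg_mono {U V : Finset ι} {m l : ℕ} (hU : U ⊆ V) (hm : m ≤ l) :
    lowDeg U m ≤ lowDeg V l :=
  Submodule.span_mono (Set.image_mono fun _ hS => ⟨hS.1.trans hU, hS.2.trans_le hm⟩)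

theorem lowDeg_induction {U : Finset ι} {m : ℕ} {P : ((ι → Bool) → ℝ) → Prop}
    (hchi : ∀ S, S ⊆ U → S.card < m → P (chi S)) (hzero : P 0)
    (hadd : ∀ f g, P f → P g → P (f + g)) (hsmul : ∀ (a : ℝ) f, P f → P (a • f))
    {f : (ι → Bool) → ℝ} (hf : f ∈ lowDeg U m) : P f := by
  induction hf using Submodule.span_induction with
  | mem x hx => obtain ⟨S, ⟨h1, h2⟩, rfl⟩ := hx; exact hchi S h1 h2
  | zero => exact hzero
  | add f g _ _ hf hg => exact hadd f g hf hg
  | smul a f _ hf => exact hsmul a f hf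

theorem permute_apply (π : Equiv.Perm ι) (f : (ι → Bool) → ℝ) (σ : ι → Bool) :
    permute π f σ = f (σ ∘ π) := rfl

theorem permute_mul (π : Equiv.Perm ι) (f g : (ι → Bool) → ℝ) :
    permute π (f * g) = permute π f * permute π g := rfl

theorem permute_permute (π τ : Equiv.Perm ι) (f : (ι → Bool) → ℝ) :
    permute π (permute τ f) = permute (π * τ) f := rfl

theorem permute_chi (π : Equiv.Perm ι) (S : Finset ι) :
    permute π (chi S) = chi (S.map π.toEmbedding) := by
  ext σ
  simp [permute_apply, chi, Finset.prod_map]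

theorem chi_empty : chi (∅ : Finset ι) = 1 := by
  ext σ; simp [chi]

theorem chi_singleton_apply (i : ι) (σ : ι → Bool) :
    chi {i} σ = if σ i then (1 : ℝ) else -1 := by
  simp [chi]

theorem sliceForm_apply (U : Finset ι) (s : ℝ) (σ : ι → Bool) :
    sliceForm U s σ = ∑ i ∈ U, (if σ i then (1 : ℝ) else -1) - s := by
  simp [sliceForm, chi_singleton_apply]

theorem permute_sliceForm {π : Equiv.Perm ι} {U : Finset ι} (hπ : U.map π.toEmbedding = U)
    (s : ℝ) : permute π (sliceForm U s) = sliceForm U s := by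
  ext σ
  rw [permute_apply, sliceForm_apply, sliceForm_apply]
  conv_rhs => rw [← hπ]
  simp [Finset.sum_map]

theorem permute_mem_lowDeg {π : Equiv.Perm ι} {U : Finset ι} (hπ : U.map π.toEmbedding = U)
    {m : ℕ} {f : (ι → Bool) → ℝ} (hf : f ∈ lowDeg U m) : permute π f ∈ lowDeg U m := by
  refine lowDeg_induction (P := fun f => permute π f ∈ lowDeg U m) ?_ ?_ ?_ ?_ hf
  · intro S hS hm
    rw [permute_chi]
    refine chi_mem_lowDeg ?_ (by simpa using hm)
    conv_rhs => rw [← hπ]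
    exact Finset.map_subset_map.2 hS
  · simp
  · intro f g hf hg
    simpa using Submodule.add_mem _ hf hg
  · intro a f hf
    simpa using Submodule.smul_mem _ a hf

theorem mul_mem_sliceIdeal {U : Finset ι} {s : ℝ} {m : ℕ} {h : (ι → Bool) → ℝ}
    (hh : h ∈ lowDeg U m) : sliceForm U s * h ∈ sliceIdeal U s m :=
  ⟨h, hh, rfl⟩

theorem permute_mem_sliceIdeal {π : Equiv.Perm ι} {U : Finset ι}
    (hπ : U.map π.toEmbedding = U) {s : ℝ} {m : ℕ} {f : (ι → Bool) → ℝ}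
    (hf : f ∈ sliceIdeal U s m) : permute π f ∈ sliceIdeal U s m := by
  obtain ⟨h, hh, rfl⟩ := hf
  rw [LinearMap.mulLeft_apply, permute_mul, permute_sliceForm hπ]
  exact mul_mem_sliceIdeal (permute_mem_lowDeg hπ hh)

theorem eq_zero_of_mem_sliceIdeal {U : Finset ι} {s : ℝ} {m : ℕ} {f : (ι → Bool) → ℝ}
    (hf : f ∈ sliceIdeal U s m) {σ : ι → Bool} (hσ : sliceForm U s σ = 0) : f σ = 0 := by
  obtain ⟨h, -, rfl⟩ := hf
  simp [hσ]

theorem lowDeg_congr {U : Finset ι} {m : ℕ} {f : (ι → Bool) → ℝ} (hf : f ∈ lowDeg U m)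
    {σ τ : ι → Bool} (h : ∀ i ∈ U, σ i = τ i) : f σ = f τ := by
  refine lowDeg_induction (P := fun f => f σ = f τ) ?_ rfl ?_ ?_ hf
  · intro S hS _
    exact Finset.prod_congr rfl fun i hi => by rw [h i (hS hi)]
  · intro f g hf hg
    simp [hf, hg]
  · intro a f hf
    simp [hf]

theorem sliceForm_congr {U : Finset ι} {s : ℝ} {σ τ : ι → Bool} (h : ∀ i ∈ U, σ i = τ i) :
    sliceForm U s σ = sliceForm U s τ := by
  rw [sliceForm_apply, sliceForm_apply]
  exact congrArg (· - s) (Finset.sum_congr rfl fun i hi => by rw [h i hi])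

variable [DecidableEq ι]

theorem chi_mul_chi_singleton (S : Finset ι) (b : ι) :
    chi {b} * chi S = chi (symmDiff S {b}) := by
  ext σ
  by_cases hb : b ∈ S
  · have h1 : symmDiff S {b} = S.erase b := by
      ext i; simp only [Finset.mem_symmDiff, Finset.mem_singleton, Finset.mem_erase]; grind
    rw [h1, Pi.mul_apply, chi_singleton_apply, chi, chi, ← Finset.mul_prod_erase S _ hb,
      ← mul_assoc]
    split_ifs <;> simp
  · have h1 : symmDiff S {b} = insert b S := by
      ext i; simp only [Finset.mem_symmDiff, Finset.mem_singleton, Finset.mem_insert]; grind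
    rw [h1, Pi.mul_apply, chi_singleton_apply, chi, chi, Finset.prod_insert hb]

theorem card_symmDiff_singleton_le (S : Finset ι) (b : ι) :
    (symmDiff S {b}).card ≤ S.card + 1 := by
  have : symmDiff S {b} ⊆ insert b S := by
    intro i; simp only [Finset.mem_symmDiff, Finset.mem_singleton, Finset.mem_insert]; grind
  exact (Finset.card_le_card this).trans (Finset.card_insert_le _ _)

theorem map_swap_of_mem {U : Finset ι} {i j : ι} (hi : i ∈ U) (hj : j ∈ U) :
    U.map (Equiv.swap i j).toEmbedding = U := by
  ext l
  simp only [Finset.mem_map_equiv, Equiv.symm_swap]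
  rcases eq_or_ne l i with rfl | h1
  · simp [hi, hj]
  rcases eq_or_ne l j with rfl | h2
  · simp [hi, hj]
  rw [Equiv.swap_apply_of_ne_of_ne h1 h2]

theorem map_swap_of_notMem {U : Finset ι} {i j : ι} (hi : i ∉ U) (hj : j ∉ U) :
    U.map (Equiv.swap i j).toEmbedding = U := by
  ext l
  simp only [Finset.mem_map_equiv, Equiv.symm_swap]
  rcases eq_or_ne l i with rfl | h1
  · simp [hi, hj]
  rcases eq_or_ne l j with rfl | h2
  · simp [hi, hj]
  rw [Equiv.swap_apply_of_ne_of_ne h1 h2]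

theorem map_swap_of_mem_of_notMem {U : Finset ι} {i j : ι} (hi : i ∈ U) (hj : j ∉ U) :
    U.map (Equiv.swap i j).toEmbedding = symmDiff (U.erase i) {j} := by
  ext l
  simp only [Finset.mem_map_equiv, Equiv.symm_swap, Finset.mem_symmDiff, Finset.mem_erase,
    Finset.mem_singleton]
  rcases eq_or_ne l i with rfl | h1
  · simp only [Equiv.swap_apply_left]; grind
  rcases eq_or_ne l j with rfl | h2
  · simp [hi, hj]
  rw [Equiv.swap_apply_of_ne_of_ne h1 h2]; grind

/-- The discrete derivative along a transposition has lower degree. -/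
theorem exists_sub_permute_swap_eq {U : Finset ι} {m : ℕ} {f : (ι → Bool) → ℝ}
    (hf : f ∈ lowDeg U (m + 1)) {i j : ι} (hij : i ≠ j) :
    ∃ g ∈ lowDeg ((U.erase i).erase j) m,
      f - permute (Equiv.swap i j) f = (chi {i} - chi {j}) * g := by
  have key : ∀ S : Finset ι, ∀ i j : ι, i ≠ j → i ∈ S → j ∉ S →
      chi S - permute (Equiv.swap i j) (chi S) = (chi {i} - chi {j}) * chi (S.erase i) := by
    intro S i j hij hi hj
    rw [permute_chi, map_swap_of_mem_of_notMem hi hj, ← chi_mul_chi_singleton, sub_mul,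
      chi_mul_chi_singleton (S.erase i) i]
    congr 2
    ext l; simp only [Finset.mem_symmDiff, Finset.mem_singleton, Finset.mem_erase]; grind
  refine lowDeg_induction (P := fun f => ∃ g ∈ lowDeg ((U.erase i).erase j) m,
      f - permute (Equiv.swap i j) f = (chi {i} - chi {j}) * g) ?_ ?_ ?_ ?_ hf
  · intro S hS hm
    by_cases hi : i ∈ S <;> by_cases hj : j ∈ S
    · exact ⟨0, Submodule.zero_mem _, by rw [permute_chi, map_swap_of_mem hi hj]; simp⟩
    · refine ⟨chi (S.erase i), chi_mem_lowDeg ?_ ?_, key S i j hij hi hj⟩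
      · intro l hl
        have := hS (Finset.mem_of_mem_erase hl)
        simp only [Finset.mem_erase] at hl ⊢; grind
      · have := Finset.card_erase_lt_of_mem hi; omega
    · refine ⟨-chi (S.erase j), Submodule.neg_mem _ (chi_mem_lowDeg ?_ ?_), ?_⟩
      · intro l hl
        have := hS (Finset.mem_of_mem_erase hl)
        simp only [Finset.mem_erase] at hl ⊢; grind
      · have := Finset.card_erase_lt_of_mem hj; omega
      · rw [Equiv.swap_comm, key S j i hij.symm hj hi]; ring
    · exact ⟨0, Submodule.zero_mem _, by rw [permute_chi, map_swap_of_notMem hi hj]; simp⟩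
  · exact ⟨0, Submodule.zero_mem _, by simp⟩
  · rintro f₁ f₂ ⟨g₁, h₁, e₁⟩ ⟨g₂, h₂, e₂⟩
    refine ⟨g₁ + g₂, Submodule.add_mem _ h₁ h₂, ?_⟩
    rw [mul_add, ← e₁, ← e₂, map_add]; ring
  · rintro a f ⟨g, h, e⟩
    refine ⟨a • g, Submodule.smul_mem _ a h, ?_⟩
    rw [mul_smul_comm, ← e, map_smul, smul_sub]

/-- The sum of the images of a function under all permutations of the coordinates in `A`. -/
noncomputable def symmetrize (A : Finset ι) : ((ι → Bool) → ℝ) →ₗ[ℝ] ((ι → Bool) → ℝ) :=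
  ∑ π : Equiv.Perm {x // x ∈ A}, permute (Equiv.Perm.ofSubtype π)

theorem symmetrize_apply (A : Finset ι) (f : (ι → Bool) → ℝ) :
    symmetrize A f = ∑ π : Equiv.Perm {x // x ∈ A}, permute (Equiv.Perm.ofSubtype π) f := by
  simp [symmetrize]

theorem map_ofSubtype {A U : Finset ι} (hA : A ⊆ U) (π : Equiv.Perm {x // x ∈ A}) :
    U.map (Equiv.Perm.ofSubtype π).toEmbedding = U := by
  apply Finset.eq_of_subset_of_card_le _ (by simp)
  intro l hl
  obtain ⟨i, hi, rfl⟩ := Finset.mem_map.1 hl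
  by_cases h : i ∈ A
  · simpa [Equiv.Perm.ofSubtype_apply_of_mem π h] using hA (π ⟨i, h⟩).2
  · simpa [Equiv.Perm.ofSubtype_apply_of_not_mem π h] using hi

theorem symmetrize_mem_sliceIdeal {A U : Finset ι} (hA : A ⊆ U) {s : ℝ} {m : ℕ}
    {f : (ι → Bool) → ℝ} (hf : f ∈ sliceIdeal U s m) : symmetrize A f ∈ sliceIdeal U s m := by
  rw [symmetrize_apply]
  exact Submodule.sum_mem _ fun π _ => permute_mem_sliceIdeal (map_ofSubtype hA π) hf

theorem symmetrize_permute_swap {A : Finset ι} {i j : ι} (hi : i ∈ A) (hj : j ∈ A)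
    (f : (ι → Bool) → ℝ) : symmetrize A (permute (Equiv.swap i j) f) = symmetrize A f := by
  rw [symmetrize_apply, symmetrize_apply]
  have h : Equiv.swap i j = Equiv.Perm.ofSubtype (Equiv.swap (⟨i, hi⟩ : {x // x ∈ A}) ⟨j, hj⟩) := by
    rw [Equiv.Perm.ofSubtype_swap_eq]
  simp_rw [permute_permute, h, ← map_mul]
  exact Fintype.sum_equiv (Equiv.mulRight _) _ _ fun π => rfl

theorem symmetrize_sub_mem {A U : Finset ι} (hA : A ⊆ U) {s : ℝ} {m : ℕ} {f : (ι → Bool) → ℝ}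
    (hf : ∀ i ∈ A, ∀ j ∈ A, f - permute (Equiv.swap i j) f ∈ sliceIdeal U s m) :
    (Fintype.card (Equiv.Perm {x // x ∈ A}) : ℝ) • f - symmetrize A f ∈ sliceIdeal U s m := by
  have key : ∀ π : Equiv.Perm {x // x ∈ A},
      f - permute (Equiv.Perm.ofSubtype π) f ∈ sliceIdeal U s m := by
    intro π
    induction π using Equiv.Perm.swap_induction_on with
    | one =>
      have : permute (1 : Equiv.Perm ι) f = f := rfl
      simp [this]
    | swap_mul π x y _ ih =>
      have h1 := hf x x.2 y y.2
      have h2 := permute_mem_sliceIdeal (map_swap_of_mem (hA x.2) (hA y.2)) ih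
      have h3 := Submodule.add_mem _ h1 h2
      rw [map_sub, permute_permute, sub_add_sub_cancel] at h3
      rwa [map_mul, Equiv.Perm.ofSubtype_swap_eq]
  have : (Fintype.card (Equiv.Perm {x // x ∈ A}) : ℝ) • f - symmetrize A f =
      ∑ π : Equiv.Perm {x // x ∈ A}, (f - permute (Equiv.Perm.ofSubtype π) f) := by
    rw [Finset.sum_sub_distrib, symmetrize_apply]
    simp [Nat.cast_smul_eq_nsmul]
  rw [this]
  exact Submodule.sum_mem _ fun π _ => key π

theorem symmetrize_chi_mem {A U : Finset ι} (hA : A ⊆ U) (s : ℝ) (m r : ℕ) :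
    ∀ S : Finset ι, S ⊆ U → S.card < m + 1 → (S ∩ A).card = r →
      symmetrize A (chi S) ∈ lowDeg (U \ A) (m + 1) ⊔ sliceIdeal U s m := by
  induction r using Nat.strong_induction_on with
  | _ r ih =>
  intro S hS hm hr
  rcases (S ∩ A).eq_empty_or_nonempty with h0 | ⟨a, ha⟩
  · refine Submodule.mem_sup_left ?_
    have hdisj : ∀ i ∈ S, i ∉ A := fun i hi hiA => by
      have : i ∈ S ∩ A := Finset.mem_inter.2 ⟨hi, hiA⟩
      simp [h0] at this
    rw [symmetrize_apply]
    refine Submodule.sum_mem _ fun π _ => ?_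
    have : permute (Equiv.Perm.ofSubtype π) (chi S) = chi S := by
      ext σ
      refine Finset.prod_congr rfl fun i hi => ?_
      simp [Equiv.Perm.ofSubtype_apply_of_not_mem π (hdisj i hi)]
    rw [this]
    exact chi_mem_lowDeg (fun i hi => Finset.mem_sdiff.2 ⟨hS hi, hdisj i hi⟩) hm
  obtain ⟨haS, haA⟩ := Finset.mem_inter.1 ha
  set Q := lowDeg (U \ A) (m + 1) ⊔ sliceIdeal U s m with hQ
  set S' := S.erase a with hS'
  have hcard : S'.card + 1 = S.card := Finset.card_erase_add_one haS
  have hinter : (S' ∩ A).card + 1 = r := by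
    rw [hS', Finset.erase_inter, Finset.card_erase_add_one ha, hr]
  have hS'U : S' ⊆ U := (Finset.erase_subset _ _).trans hS
  have hfull : symmetrize A (sliceForm U s * chi S') ∈ Q :=
    Submodule.mem_sup_right (symmetrize_mem_sliceIdeal hA
      (mul_mem_sliceIdeal (chi_mem_lowDeg hS'U (by omega))))
  have hexp : sliceForm U s * chi S' = ∑ b ∈ A, chi (symmDiff S' {b}) +
      ∑ b ∈ U \ A, chi (symmDiff S' {b}) - s • chi S' := by
    have h1 : sliceForm U s * chi S' = (∑ b ∈ U, chi {b}) * chi S' - s • chi S' := by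
      ext σ; simp [sliceForm]; ring
    rw [h1, Finset.sum_mul, add_comm, Finset.sum_sdiff hA]
    simp_rw [chi_mul_chi_singleton]
  have hS'Q : symmetrize A (chi S') ∈ Q := ih _ (by omega) S' hS'U (by omega) rfl
  have hout : ∀ b ∈ U \ A, symmetrize A (chi (symmDiff S' {b})) ∈ Q := by
    intro b hb
    obtain ⟨hbU, hbA⟩ := Finset.mem_sdiff.1 hb
    have h1 : symmDiff S' {b} ∩ A = S' ∩ A := by
      ext l; simp only [Finset.mem_inter, Finset.mem_symmDiff, Finset.mem_singleton]; grind
    refine ih (S' ∩ A).card (by omega) _ ?_ ?_ (by rw [h1])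
    · intro l; simp only [Finset.mem_symmDiff, Finset.mem_singleton]; grind
    · have := card_symmDiff_singleton_le S' b; omega
  have hin : ∀ b ∈ S' ∩ A, symmetrize A (chi (symmDiff S' {b})) ∈ Q := by
    intro b hb
    have hb' := (Finset.mem_inter.1 hb).1
    have h1 : symmDiff S' {b} = S'.erase b := by
      ext l; simp only [Finset.mem_erase, Finset.mem_symmDiff, Finset.mem_singleton]; grind
    have h2 := Finset.card_erase_add_one hb'
    rw [h1]
    refine ih _ ?_ _ ((Finset.erase_subset _ _).trans hS'U) (by omega) rfl
    rw [Finset.erase_inter]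
    have := Finset.card_erase_lt_of_mem hb
    omega
  have hnew : ∀ b ∈ A \ S', symmetrize A (chi (symmDiff S' {b})) = symmetrize A (chi S) := by
    intro b hb
    obtain ⟨hbA, hbS⟩ := Finset.mem_sdiff.1 hb
    rw [← symmetrize_permute_swap haA hbA (chi S)]
    rcases eq_or_ne b a with rfl | hne
    · have : symmDiff S' {b} = S := by
        ext l; simp only [hS', Finset.mem_erase, Finset.mem_symmDiff, Finset.mem_singleton]; grind
      rw [this, Equiv.swap_self]; rfl
    · have hbS' : b ∉ S := fun h => hbS (Finset.mem_erase.2 ⟨hne, h⟩)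
      rw [permute_chi, map_swap_of_mem_of_notMem haS hbS']
  have hsplit : ∑ b ∈ A, symmetrize A (chi (symmDiff S' {b})) =
      ((A \ S').card : ℝ) • symmetrize A (chi S) +
        ∑ b ∈ S' ∩ A, symmetrize A (chi (symmDiff S' {b})) := by
    rw [Finset.inter_comm, ← Finset.sum_sdiff (Finset.inter_subset_left (s₁ := A) (s₂ := S')),
      Finset.sdiff_inter_self_left, Finset.sum_congr rfl hnew, Finset.sum_const,
      Nat.cast_smul_eq_nsmul]
  rw [hexp, map_sub, map_add, map_sum, map_sum, hsplit, map_smul] at hfull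
  have h3 := Submodule.sub_mem _ (Submodule.add_mem _ hfull (Submodule.smul_mem _ s hS'Q))
    (Submodule.add_mem _ (Submodule.sum_mem _ hin) (Submodule.sum_mem _ hout))
  have h4 : ((A \ S').card : ℝ) • symmetrize A (chi S) ∈ Q := by
    convert h3 using 1
    abel
  have hpos : ((A \ S').card : ℝ) ≠ 0 := by
    have : a ∈ A \ S' := by simp [hS', haA]
    exact_mod_cast (Finset.card_pos.2 ⟨a, this⟩).ne'
  exact (Submodule.smul_mem_iff _ hpos).1 h4

/-- A function of low degree which is invariant, modulo the ideal of the slice, under the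
permutations of `A` can be rewritten without the variables in `A`. -/
theorem exists_lowDeg_sdiff_of_invariant {A U : Finset ι} (hA : A ⊆ U) {s : ℝ} {m : ℕ}
    {f : (ι → Bool) → ℝ} (hf : f ∈ lowDeg U (m + 1))
    (hinv : ∀ i ∈ A, ∀ j ∈ A, f - permute (Equiv.swap i j) f ∈ sliceIdeal U s m) :
    ∃ g ∈ lowDeg (U \ A) (m + 1), f - g ∈ sliceIdeal U s m := by
  have h1 : symmetrize A f ∈ lowDeg (U \ A) (m + 1) ⊔ sliceIdeal U s m := by
    refine lowDeg_induction (P := fun f => symmetrize A f ∈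
      lowDeg (U \ A) (m + 1) ⊔ sliceIdeal U s m) ?_ ?_ ?_ ?_ hf
    · exact fun S hS hm => symmetrize_chi_mem hA s m _ S hS hm rfl
    · simp
    · intro f g hf hg
      rw [map_add]; exact Submodule.add_mem _ hf hg
    · intro a f hf
      rw [map_smul]; exact Submodule.smul_mem _ a hf
  have h2 := Submodule.add_mem _ (Submodule.mem_sup_right (symmetrize_sub_mem hA hinv)) h1
  rw [sub_add_cancel, Submodule.smul_mem_iff _ (by exact_mod_cast Fintype.card_ne_zero)] at h2
  obtain ⟨g, hg, q, hq, rfl⟩ := Submodule.mem_sup.1 h2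
  exact ⟨g, hg, by simpa using hq⟩

end Cube

section Slice

variable {ι : Type*} [DecidableEq ι]

/-- The point of the cube whose coordinates in `A` are `-1`. -/
def indicatorPoint (A : Finset ι) : ι → Bool := fun i => decide (i ∉ A)

theorem sliceForm_indicatorPoint {A U : Finset ι} (hA : A ⊆ U) (s : ℝ) :
    sliceForm U s (indicatorPoint A) = (U.card : ℝ) - 2 * A.card - s := by
  rw [sliceForm_apply, ← Finset.sum_sdiff hA]
  have h1 : ∑ i ∈ U \ A, (if indicatorPoint A i then (1 : ℝ) else -1) = ∑ i ∈ U \ A, 1 :=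
    Finset.sum_congr rfl fun i hi => by simp [indicatorPoint, (Finset.mem_sdiff.1 hi).2]
  have h2 : ∑ i ∈ A, (if indicatorPoint A i then (1 : ℝ) else -1) = ∑ i ∈ A, (-1) :=
    Finset.sum_congr rfl fun i hi => by simp [indicatorPoint, hi]
  have h3 : ((U \ A).card : ℝ) + A.card = U.card := by
    exact_mod_cast Finset.card_sdiff_add_card_eq_card hA
  rw [h1, h2, ← h3]
  simp
  ring

theorem sliceForm_erase_erase {U : Finset ι} {i j : ι} (hi : i ∈ U) (hj : j ∈ U) (hij : i ≠ j)
    (s : ℝ) (σ : ι → Bool) :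
    sliceForm U s σ = sliceForm ((U.erase i).erase j) s σ + chi {i} σ + chi {j} σ := by
  rw [sliceForm_apply, sliceForm_apply, ← Finset.add_sum_erase U _ hi,
    ← Finset.add_sum_erase (U.erase i) _ (Finset.mem_erase.2 ⟨hij.symm, hj⟩),
    chi_singleton_apply, chi_singleton_apply]
  ring

theorem card_erase_erase_add_two {U : Finset ι} {i j : ι} (hi : i ∈ U) (hj : j ∈ U)
    (hij : i ≠ j) : ((U.erase i).erase j).card + 2 = U.card := by
  rw [← Finset.card_erase_add_one hi,
    ← Finset.card_erase_add_one (Finset.mem_erase.2 ⟨hij.symm, hj⟩)]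

theorem exists_lowDeg_sdiff_of_slice_invariant (m : ℕ) :
    ∀ (U : Finset ι) (k : ℕ), m ≤ k → m + k ≤ U.card → ∀ f ∈ lowDeg U (m + 1), ∀ A ⊆ U,
      (∀ i ∈ A, ∀ j ∈ A, ∀ σ, sliceForm U (U.card - 2 * k) σ = 0 →
        f (σ ∘ Equiv.swap i j) = f σ) →
      ∃ g ∈ lowDeg (U \ A) (m + 1), f - g ∈ sliceIdeal U (U.card - 2 * k) m := by
  induction m with
  | zero =>
    intro U k _ _ f hf A _ _
    refine ⟨f, ?_, by simp⟩
    refine Submodule.span_mono (Set.image_mono ?_) hf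
    rintro S ⟨-, hS⟩
    have : S = ∅ := by simpa using hS
    simp [this]
  | succ m ih =>
    intro U k hmk hmU f hf A hA hinv
    refine exists_lowDeg_sdiff_of_invariant hA hf fun i hi j hj => ?_
    rcases eq_or_ne i j with rfl | hij
    · have : permute (Equiv.swap i i) f = f := by rw [Equiv.swap_self]; rfl
      rw [this, sub_self]
      exact Submodule.zero_mem _
    have hiU := hA hi
    have hjU := hA hj
    obtain ⟨g, hg, hfg⟩ := exists_sub_permute_swap_eq hf hij
    set V := (U.erase i).erase j with hV
    have hcard : V.card + 2 = U.card := card_erase_erase_add_two hiU hjU hij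
    have hs : (U.card : ℝ) - 2 * k = V.card - 2 * ((k - 1 : ℕ) : ℝ) := by
      rw [← hcard, Nat.cast_sub (by omega)]; push_cast; ring
    have hvanish : ∀ σ, sliceForm V (U.card - 2 * k) σ = 0 → g σ = 0 := by
      intro σ hσ
      let τ : ι → Bool := Function.update (Function.update σ i true) j false
      have hτi : τ i = true := by simp [τ, hij]
      have hτj : τ j = false := by simp [τ]
      have hτ : ∀ l ∈ V, σ l = τ l := by
        intro l hl
        have h1 : l ≠ j ∧ l ≠ i ∧ l ∈ U := by simpa [hV] using hl
        simp [τ, h1.1, h1.2.1]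
      have h2 : sliceForm U (U.card - 2 * k) τ = 0 := by
        rw [sliceForm_erase_erase hiU hjU hij, chi_singleton_apply, chi_singleton_apply, hτi, hτj]
        rw [← hV, ← sliceForm_congr hτ, hσ]
        simp
      have h3 := congrFun hfg τ
      rw [Pi.sub_apply, permute_apply, hinv i hi j hj τ h2, Pi.mul_apply, Pi.sub_apply,
        chi_singleton_apply, chi_singleton_apply, hτi, hτj] at h3
      rw [lowDeg_congr hg hτ]
      simpa using h3
    have hVker : ∀ σ, sliceForm V (V.card - 2 * ((k - 1 : ℕ) : ℝ)) σ = 0 → g σ = 0 := by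
      rw [← hs]; exact hvanish
    obtain ⟨c, hc, hgc⟩ := ih V (k - 1) (by omega) (by omega) g hg V subset_rfl (by
      intro i' hi' j' hj' σ hσ
      rw [hVker σ hσ]
      refine hVker _ ?_
      have := congrFun (permute_sliceForm (map_swap_of_mem hi' hj')
        ((V.card : ℝ) - 2 * ((k - 1 : ℕ) : ℝ))) σ
      rwa [hσ, permute_apply] at this)
    obtain ⟨B, hBV, hB⟩ := Finset.exists_subset_card_eq (s := V) (n := k - 1) (by omega)
    have hBslice : sliceForm V (V.card - 2 * ((k - 1 : ℕ) : ℝ)) (indicatorPoint B) = 0 := by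
      rw [sliceForm_indicatorPoint hBV, hB]; ring
    have hc0 : c = 0 := by
      have h1 := eq_zero_of_mem_sliceIdeal hgc hBslice
      rw [Pi.sub_apply, hVker _ hBslice, zero_sub, neg_eq_zero] at h1
      ext σ
      rw [lowDeg_congr hc (τ := indicatorPoint B) (by simp), h1]; rfl
    rw [hc0, sub_zero, ← hs] at hgc
    obtain ⟨h, hh, rfl⟩ := hgc
    rw [hfg, LinearMap.mulLeft_apply]
    have hprod : (chi {i} - chi {j}) * (sliceForm V (U.card - 2 * k) * h) =
        sliceForm U (U.card - 2 * k) * ((chi {i} - chi {j}) * h) := by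
      ext σ
      simp only [Pi.mul_apply, Pi.sub_apply]
      rw [sliceForm_erase_erase hiU hjU hij, chi_singleton_apply, chi_singleton_apply]
      split_ifs <;> ring
    rw [hprod]
    refine mul_mem_sliceIdeal ?_
    refine lowDeg_induction (P := fun h => (chi {i} - chi {j}) * h ∈ lowDeg U (m + 1))
      ?_ ?_ ?_ ?_ hh
    · intro S hS hm
      have hSU : S ⊆ U := hS.trans ((Finset.erase_subset _ _).trans (Finset.erase_subset _ _))
      have h1 : ∀ b ∈ U, chi (symmDiff S {b}) ∈ lowDeg U (m + 1) := by
        intro b hb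
        refine chi_mem_lowDeg ?_ ?_
        · intro l; simp only [Finset.mem_symmDiff, Finset.mem_singleton]; grind
        · have := card_symmDiff_singleton_le S b; omega
      rw [sub_mul, chi_mul_chi_singleton, chi_mul_chi_singleton]
      exact Submodule.sub_mem _ (h1 i hiU) (h1 j hjU)
    · simp
    · intro h₁ h₂ H₁ H₂
      rw [mul_add]; exact Submodule.add_mem _ H₁ H₂
    · intro a h H
      rw [mul_smul_comm]; exact Submodule.smul_mem _ a H

theorem choose_sub_le_choose (n k m : ℕ) (hk : m ≤ k) (hn : 2 * m ≤ n) :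
    (n - 2 * m).choose (k - m) ≤ n.choose k := by
  induction m with
  | zero => simp
  | succ m ih =>
    refine le_trans ?_ (ih (by omega) (by omega))
    obtain ⟨a, ha⟩ : ∃ a, n = a + 2 * (m + 1) := ⟨n - 2 * (m + 1), by omega⟩
    obtain ⟨b, hb⟩ : ∃ b, k = b + (m + 1) := ⟨k - (m + 1), by omega⟩
    have h1 : n - 2 * (m + 1) = a := by omega
    have h2 : n - 2 * m = a + 1 + 1 := by omega
    have h3 : k - (m + 1) = b := by omega
    have h4 : k - m = b + 1 := by omega
    rw [h1, h2, h3, h4, Nat.choose_succ_succ, Nat.choose_succ_succ]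
    omega

/-- A Schwartz–Zippel bound on the slice. -/
theorem choose_le_card_filter_ne_zero (m : ℕ) :
    ∀ (U : Finset ι) (k : ℕ), m ≤ k → m + k ≤ U.card → ∀ f ∈ lowDeg U (m + 1),
      (∃ A ∈ U.powersetCard k, f (indicatorPoint A) ≠ 0) →
      (U.card - 2 * m).choose (k - m) ≤
        ((U.powersetCard k).filter fun A => f (indicatorPoint A) ≠ 0).card := by
  induction m with
  | zero =>
    rintro U k - - f hf ⟨A, hA, hfA⟩
    rw [Finset.filter_true_of_mem, Finset.card_powersetCard]
    · simp
    · intro B hB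
      have hf' : f ∈ lowDeg (∅ : Finset ι) 1 := by
        refine Submodule.span_mono (Set.image_mono ?_) hf
        rintro S ⟨-, hS⟩
        have : S = ∅ := by simpa using hS
        simp [this]
      rwa [lowDeg_congr hf' (τ := indicatorPoint A) (by simp)]
  | succ m ih =>
    rintro U k hmk hmU f hf ⟨A, hA, hfA⟩
    have hslice : ∀ B ∈ U.powersetCard k,
        sliceForm U (U.card - 2 * k) (indicatorPoint B) = 0 := by
      intro B hB
      obtain ⟨h1, h2⟩ := Finset.mem_powersetCard.1 hB
      rw [sliceForm_indicatorPoint h1, h2]; ring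
    by_cases hinv : ∀ i ∈ U, ∀ j ∈ U, ∀ σ, sliceForm U (U.card - 2 * k) σ = 0 →
        f (σ ∘ Equiv.swap i j) = f σ
    · obtain ⟨g, hg, hfg⟩ := exists_lowDeg_sdiff_of_slice_invariant (m + 1) U k hmk hmU f hf U
        subset_rfl hinv
      have hval : ∀ B ∈ U.powersetCard k, f (indicatorPoint B) = g (indicatorPoint B) :=
        fun B hB => sub_eq_zero.1 (eq_zero_of_mem_sliceIdeal hfg (hslice B hB))
      rw [Finset.filter_true_of_mem, Finset.card_powersetCard]
      · exact choose_sub_le_choose _ _ _ hmk (by omega)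
      · intro B hB
        rw [hval B hB, lowDeg_congr hg (τ := indicatorPoint A) (by simp), ← hval A hA]
        exact hfA
    · push Not at hinv
      obtain ⟨i, hiU, j, hjU, σ, hσ, hne⟩ := hinv
      have hij : i ≠ j := by
        rintro rfl
        exact hne (by rw [Equiv.swap_self]; rfl)
      obtain ⟨g, hg, hfg⟩ := exists_sub_permute_swap_eq hf hij
      set V := (U.erase i).erase j with hV
      have hcard : V.card + 2 = U.card := card_erase_erase_add_two hiU hjU hij
      have hiV : i ∉ V := by simp [hV]
      have hjV : j ∉ V := by simp [hV]
      have hVU : V ⊆ U := (Finset.erase_subset _ _).trans (Finset.erase_subset _ _)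
      have h1 := congrFun hfg σ
      rw [Pi.sub_apply, permute_apply, Pi.mul_apply, Pi.sub_apply] at h1
      have h2 : (chi {i} σ - chi {j} σ) * g σ ≠ 0 := by
        rw [← h1]; exact sub_ne_zero.2 hne.symm
      obtain ⟨h3, h4⟩ := mul_ne_zero_iff.1 h2
      have h5 : chi {i} σ + chi {j} σ = 0 := by
        rw [chi_singleton_apply, chi_singleton_apply] at h3 ⊢
        revert h3
        split_ifs <;> simp
      rw [sliceForm_erase_erase hiU hjU hij, add_assoc, h5, add_zero] at hσ
      have hagree : ∀ l ∈ V, σ l = indicatorPoint (V.filter fun l => σ l = false) l := by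
        intro l hl
        simp [indicatorPoint, hl]
      have hσ' : sliceForm V (U.card - 2 * k)
          (indicatorPoint (V.filter fun l => σ l = false)) = 0 := by
        rw [← hσ, sliceForm_congr hagree]
      rw [sliceForm_indicatorPoint (Finset.filter_subset _ _), ← hcard] at hσ'
      have hBcard : (V.filter fun l => σ l = false).card + 1 = k := by
        push_cast at hσ'
        have : ((V.filter fun l => σ l = false).card : ℝ) + 1 = k := by linarith
        exact_mod_cast this
      have hbound := ih V (k - 1) (by omega) (by omega) g hg
        ⟨V.filter fun l => σ l = false,
            Finset.mem_powersetCard.2 ⟨Finset.filter_subset _ _, by omega⟩, by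
          rwa [← lowDeg_congr hg hagree]⟩
      have e1 : U.card - 2 * (m + 1) = V.card - 2 * m := by omega
      have e2 : k - (m + 1) = k - 1 - m := by omega
      rw [e1, e2]
      refine hbound.trans ?_
      refine Finset.card_le_card_of_injOn
        (fun B => if f (indicatorPoint (insert i B)) ≠ 0 then insert i B else insert j B) ?_ ?_
      · intro B hB
        obtain ⟨hB1, hB2⟩ := Finset.mem_filter.1 (Finset.mem_coe.1 hB)
        obtain ⟨hBV, hBk⟩ := Finset.mem_powersetCard.1 hB1
        have hiB : i ∉ B := fun h => hiV (hBV h)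
        have hjB : j ∉ B := fun h => hjV (hBV h)
        have hins : ∀ a ∈ U, a ∉ B → insert a B ∈ U.powersetCard k := by
          intro a ha haB
          refine Finset.mem_powersetCard.2 ⟨Finset.insert_subset ha (hBV.trans hVU), ?_⟩
          rw [Finset.card_insert_of_notMem haB]; omega
        have hB' := congrFun hfg (indicatorPoint (insert i B))
        have hswap : indicatorPoint (insert i B) ∘ Equiv.swap i j =
              indicatorPoint (insert j B) := by
          ext l
          simp only [indicatorPoint, Function.comp_apply]
          rcases eq_or_ne l i with rfl | hl
          · simp [hiB, hjB, hij, hij.symm]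
          rcases eq_or_ne l j with rfl | hl'
          · simp
          · simp [Equiv.swap_apply_of_ne_of_ne hl hl', hl, hl']
        have hgB : g (indicatorPoint (insert i B)) = g (indicatorPoint B) := by
          refine lowDeg_congr hg fun l hl => ?_
          have : l ≠ i := fun h => hiV (h ▸ hl)
          simp [indicatorPoint, this]
        rw [Pi.sub_apply, permute_apply, hswap, Pi.mul_apply, Pi.sub_apply, hgB,
          chi_singleton_apply, chi_singleton_apply] at hB'
        have hpi : indicatorPoint (insert i B) i = false := by simp [indicatorPoint]
        have hpj : indicatorPoint (insert i B) j = true := by simp [indicatorPoint, hij.symm, hjB]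
        rw [hpi, hpj] at hB'
        simp only [Finset.coe_filter, Set.mem_ofPred_eq]
        split_ifs with hif
        · exact ⟨hins i hiU hiB, hif⟩
        · refine ⟨hins j hjU hjB, fun h0 => hB2 ?_⟩
          push Not at hif
          rw [hif, h0] at hB'
          norm_num at hB'
          exact hB'
      · intro B hB B' hB' heq
        have aux : ∀ B, B ∈ (↑((V.powersetCard (k - 1)).filter
            fun A => g (indicatorPoint A) ≠ 0) : Set (Finset ι)) →
            B = ((if f (indicatorPoint (insert i B)) ≠ 0 then insert i B else insert j B).erase
              i).erase j := by
          intro B hB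
          have hBV := (Finset.mem_powersetCard.1
            (Finset.mem_filter.1 (Finset.mem_coe.1 hB)).1).1
          have hiB : i ∉ B := fun h => hiV (hBV h)
          have hjB : j ∉ B := fun h => hjV (hBV h)
          ext l
          split_ifs <;> simp only [Finset.mem_erase, Finset.mem_insert] <;> grind
        rw [aux B hB, aux B' hB']
        simp only at heq
        rw [heq]

end Slice

/-- A symmetric operator acting triangularly on a filtration is bounded by its largest diagonal
entry. -/
theorem inner_map_self_le_of_triangular {E : Type*} [NormedAddCommGroup E]
    [InnerProductSpace ℝ E] [FiniteDimensional ℝ E] {T : E →ₗ[ℝ] E} (hT : T.IsSymmetric)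
    {V : ℕ → Submodule ℝ E} (hmono : ∀ m, V m ≤ V (m + 1)) (h0 : V 0 = ⊥) {lam : ℕ → ℝ}
    {M : ℕ} {C : ℝ} (hlam : ∀ m < M, lam m ≤ C)
    (hV : ∀ m, ∀ v ∈ V (m + 1), T v - lam m • v ∈ V m) :
    ∀ m ≤ M, ∀ f ∈ V m, inner ℝ (T f) f ≤ C * ‖f‖ ^ 2 := by
  intro m
  induction m with
  | zero =>
    intro _ f hf
    rw [h0, Submodule.mem_bot] at hf
    simp [hf]
  | succ m ih =>
    intro hm f hf
    obtain ⟨u, hu, r, hr, rfl⟩ := (V m).exists_add_mem_mem_orthogonal f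
    have hTu : ∀ w ∈ V m, T w ∈ V m := by
      intro w hw
      cases m with
      | zero =>
        rw [h0, Submodule.mem_bot] at hw
        simp [hw]
      | succ l =>
        have := Submodule.add_mem _ (hmono l (hV l w hw)) (Submodule.smul_mem _ (lam l) hw)
        rwa [sub_add_cancel] at this
    have hrV : r ∈ V (m + 1) := by
      have := Submodule.sub_mem _ hf (hmono m hu)
      rwa [add_sub_cancel_left] at this
    have hTr : T r = lam m • r := by
      have h1 := hV m r hrV
      have h2 : T r - lam m • r ∈ (V m)ᗮ := by
        refine Submodule.sub_mem _ ?_ (Submodule.smul_mem _ _ hr)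
        rw [Submodule.mem_orthogonal]
        intro w hw
        rw [← hT w r]
        exact (Submodule.mem_orthogonal _ _).1 hr _ (hTu w hw)
      exact sub_eq_zero.1 (inner_self_eq_zero.1 ((Submodule.mem_orthogonal _ _).1 h2 _ h1))
    have hur : inner ℝ u r = 0 := (Submodule.mem_orthogonal _ _).1 hr _ hu
    have hTur : inner ℝ (T u) r = 0 := (Submodule.mem_orthogonal _ _).1 hr _ (hTu u hu)
    have hru : inner ℝ r u = 0 := by rw [real_inner_comm, hur]
    have hnorm : ‖u + r‖ ^ 2 = ‖u‖ ^ 2 + ‖r‖ ^ 2 := by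
      rw [norm_add_sq_real, hur]; ring
    rw [map_add, inner_add_left, inner_add_right, inner_add_right, hTur, hTr, inner_smul_left,
      inner_smul_left, hru, real_inner_self_eq_norm_sq, hnorm]
    have h1 := ih (by omega) u hu
    have h2 := mul_le_mul_of_nonneg_right (hlam m (by omega)) (sq_nonneg ‖r‖)
    simp only [conj_trivial, mul_zero, add_zero, zero_add]
    linarith

section Laplacian

variable {ι : Type*} [Fintype ι] [DecidableEq ι]

/-- The sum of the discrete derivatives along all ordered transpositions. -/
noncomputable def swapLaplacian : ((ι → Bool) → ℝ) →ₗ[ℝ] ((ι → Bool) → ℝ) :=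
  ∑ i : ι, ∑ j : ι, (LinearMap.id - permute (Equiv.swap i j))

theorem swapLaplacian_eq (f : (ι → Bool) → ℝ) :
    swapLaplacian f = ∑ i : ι, ∑ j : ι, (f - permute (Equiv.swap i j) f) := by
  simp [swapLaplacian]

theorem swapLaplacian_apply (f : (ι → Bool) → ℝ) (σ : ι → Bool) :
    swapLaplacian f σ = ∑ i : ι, ∑ j : ι, (f σ - f (σ ∘ Equiv.swap i j)) := by
  rw [swapLaplacian_eq]
  simp only [Finset.sum_apply, Pi.sub_apply, permute_apply]

theorem swapLaplacian_chi (S : Finset ι) :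
    swapLaplacian (chi S) =
      (2 : ℝ) • ∑ i ∈ S, ∑ j ∈ Sᶜ, (chi S - chi (symmDiff (S.erase i) {j})) := by
  have hin : ∀ i ∈ S, ∀ j ∈ S, chi S - permute (Equiv.swap i j) (chi S) = 0 := by
    intro i hi j hj
    rw [permute_chi, map_swap_of_mem hi hj, sub_self]
  have hout : ∀ i ∈ Sᶜ, ∀ j ∈ Sᶜ, chi S - permute (Equiv.swap i j) (chi S) = 0 := by
    intro i hi j hj
    rw [permute_chi, map_swap_of_notMem (Finset.mem_compl.1 hi) (Finset.mem_compl.1 hj), sub_self]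
  have h1 : ∑ i ∈ S, ∑ j, (chi S - permute (Equiv.swap i j) (chi S)) =
      ∑ i ∈ S, ∑ j ∈ Sᶜ, (chi S - permute (Equiv.swap i j) (chi S)) := by
    refine Finset.sum_congr rfl fun i hi => ?_
    rw [← Finset.sum_add_sum_compl S, Finset.sum_eq_zero (hin i hi), zero_add]
  have h2 : ∑ i ∈ Sᶜ, ∑ j, (chi S - permute (Equiv.swap i j) (chi S)) =
      ∑ i ∈ S, ∑ j ∈ Sᶜ, (chi S - permute (Equiv.swap i j) (chi S)) := by
    rw [Finset.sum_comm, ← Finset.sum_add_sum_compl S, Finset.sum_eq_zero (s := Sᶜ)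
      fun j hj => Finset.sum_eq_zero fun i hi => hout i hi j hj, add_zero]
    exact Finset.sum_congr rfl fun i _ => Finset.sum_congr rfl fun j _ => by rw [Equiv.swap_comm]
  rw [swapLaplacian_eq, ← Finset.sum_add_sum_compl S, h1, h2, ← two_smul ℝ]
  congr 1
  refine Finset.sum_congr rfl fun i hi => Finset.sum_congr rfl fun j hj => ?_
  rw [permute_chi, map_swap_of_mem_of_notMem hi (Finset.mem_compl.1 hj)]

theorem swapLaplacian_mem_lowDeg {m : ℕ} {f : (ι → Bool) → ℝ}
    (hf : f ∈ lowDeg Finset.univ m) : swapLaplacian f ∈ lowDeg Finset.univ m := by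
  rw [swapLaplacian_eq]
  refine Submodule.sum_mem _ fun i _ => Submodule.sum_mem _ fun j _ =>
    Submodule.sub_mem _ hf (permute_mem_lowDeg (map_swap_of_mem ?_ ?_) hf) <;> simp

theorem swapLaplacian_chi_sub_mem (s : ℝ) (S : Finset ι) :
    swapLaplacian (chi S) - (2 * S.card * (Fintype.card ι - S.card + 1) : ℝ) • chi S +
      (2 : ℝ) • ∑ i ∈ S, sliceForm Finset.univ s * chi (S.erase i) ∈
        lowDeg Finset.univ S.card := by
  have hform : ∀ i, sliceForm Finset.univ s * chi (S.erase i) =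
      ∑ j, chi (symmDiff (S.erase i) {j}) - s • chi (S.erase i) := by
    intro i
    simp_rw [← chi_mul_chi_singleton, ← Finset.sum_mul]
    ext σ; simp [sliceForm]; ring
  have hself : ∀ i ∈ S, symmDiff (S.erase i) {i} = S := by
    intro i hi
    ext l; simp only [Finset.mem_symmDiff, Finset.mem_singleton, Finset.mem_erase]; grind
  have hsplit : ∀ i ∈ S, ∑ j, chi (symmDiff (S.erase i) {j}) =
      (chi S + ∑ j ∈ S.erase i, chi (symmDiff (S.erase i) {j})) +
        ∑ j ∈ Sᶜ, chi (symmDiff (S.erase i) {j}) := by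
    intro i hi
    rw [← Finset.sum_add_sum_compl S, ← Finset.add_sum_erase S _ hi, hself i hi]
  have hcompl : ((Sᶜ : Finset ι).card : ℝ) = Fintype.card ι - S.card := by
    rw [Finset.card_compl, Nat.cast_sub (Finset.card_le_univ _)]
  have key : swapLaplacian (chi S) -
        (2 * S.card * (Fintype.card ι - S.card + 1) : ℝ) • chi S +
      (2 : ℝ) • ∑ i ∈ S, sliceForm Finset.univ s * chi (S.erase i) =
      (2 : ℝ) • ∑ i ∈ S, (∑ j ∈ S.erase i, chi (symmDiff (S.erase i) {j}) -
        s • chi (S.erase i)) := by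
    have e1 : (2 * S.card * (Fintype.card ι - S.card + 1) : ℝ) • chi S =
        (2 : ℝ) • ∑ i ∈ S, ((Fintype.card ι - S.card + 1 : ℝ) • chi S) := by
      rw [Finset.sum_const, ← Nat.cast_smul_eq_nsmul ℝ, smul_smul, smul_smul, mul_assoc]
    rw [swapLaplacian_chi, e1, ← smul_sub, ← smul_add, ← Finset.sum_sub_distrib,
      ← Finset.sum_add_distrib]
    congr 1
    refine Finset.sum_congr rfl fun i hi => ?_
    rw [hform, hsplit i hi, Finset.sum_sub_distrib, Finset.sum_const,
      ← Nat.cast_smul_eq_nsmul ℝ, hcompl, add_smul, one_smul]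
    abel
  rw [key]
  refine Submodule.smul_mem _ _ (Submodule.sum_mem _ fun i hi => Submodule.sub_mem _
    (Submodule.sum_mem _ fun j hj => ?_) (Submodule.smul_mem _ _ ?_))
  · have h1 : symmDiff (S.erase i) {j} = (S.erase i).erase j := by
      ext l; simp only [Finset.mem_symmDiff, Finset.mem_singleton, Finset.mem_erase] at hj ⊢; grind
    rw [h1]
    refine chi_mem_lowDeg (Finset.subset_univ _) ?_
    exact (Finset.card_erase_le).trans_lt (Finset.card_erase_lt_of_mem hi)
  · exact chi_mem_lowDeg (Finset.subset_univ _) (Finset.card_erase_lt_of_mem hi)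

theorem exists_swapLaplacian_sub_eqOn_slice (s : ℝ) {m : ℕ} {f : (ι → Bool) → ℝ}
    (hf : f ∈ lowDeg Finset.univ (m + 1)) :
    ∃ g ∈ lowDeg Finset.univ m, ∀ σ, sliceForm Finset.univ s σ = 0 →
      swapLaplacian f σ - (2 * m * (Fintype.card ι - m + 1) : ℝ) * f σ = g σ := by
  refine lowDeg_induction (P := fun f => ∃ g ∈ lowDeg Finset.univ m,
    ∀ σ, sliceForm Finset.univ s σ = 0 →
      swapLaplacian f σ - (2 * m * (Fintype.card ι - m + 1) : ℝ) * f σ = g σ) ?_ ?_ ?_ ?_ hf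
  · intro S _ hS
    rcases Nat.lt_succ_iff_lt_or_eq.1 hS with h | rfl
    · have hS' : chi S ∈ lowDeg Finset.univ m := chi_mem_lowDeg (Finset.subset_univ _) h
      exact ⟨_, Submodule.sub_mem _ (swapLaplacian_mem_lowDeg hS') (Submodule.smul_mem _
        (2 * m * (Fintype.card ι - m + 1) : ℝ) hS'), fun σ _ => rfl⟩
    · refine ⟨_, swapLaplacian_chi_sub_mem s S, fun σ hσ => ?_⟩
      simp [hσ]
  · exact ⟨0, Submodule.zero_mem _, by simp⟩
  · rintro f₁ f₂ ⟨g₁, h₁, e₁⟩ ⟨g₂, h₂, e₂⟩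
    refine ⟨g₁ + g₂, Submodule.add_mem _ h₁ h₂, fun σ hσ => ?_⟩
    rw [map_add, Pi.add_apply, Pi.add_apply, Pi.add_apply, ← e₁ σ hσ, ← e₂ σ hσ]; ring
  · rintro a f ⟨g, h, e⟩
    refine ⟨a • g, Submodule.smul_mem _ a h, fun σ hσ => ?_⟩
    rw [map_smul, Pi.smul_apply, Pi.smul_apply, Pi.smul_apply, ← e σ hσ]
    simp only [smul_eq_mul]; ring

/-- The transposition of two coordinates on the points of a slice. -/
def sliceSwap (s : ℝ) (i j : ι) :
    {σ : ι → Bool // sliceForm Finset.univ s σ = 0} ≃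
      {σ : ι → Bool // sliceForm Finset.univ s σ = 0} :=
  Function.Involutive.toPerm
    (fun σ => ⟨σ.1 ∘ Equiv.swap i j, by
      have := congrFun (permute_sliceForm (map_swap_of_mem (Finset.mem_univ i)
        (Finset.mem_univ j)) s) σ.1
      rw [permute_apply] at this
      rw [this, σ.2]⟩)
    (fun σ => by ext l; simp)

theorem sliceSwap_coe (s : ℝ) (i j : ι) (σ : {σ : ι → Bool // sliceForm Finset.univ s σ = 0}) :
    (sliceSwap s i j σ).1 = σ.1 ∘ Equiv.swap i j := rfl

theorem sliceSwap_sliceSwap (s : ℝ) (i j : ι)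
    (σ : {σ : ι → Bool // sliceForm Finset.univ s σ = 0}) :
    sliceSwap s i j (sliceSwap s i j σ) = σ := by
  ext l; simp [sliceSwap_coe]

/-- The restriction of `swapLaplacian` to a slice. -/
noncomputable def sliceLaplacian (s : ℝ) :
    EuclideanSpace ℝ {σ : ι → Bool // sliceForm Finset.univ s σ = 0} →ₗ[ℝ]
      EuclideanSpace ℝ {σ : ι → Bool // sliceForm Finset.univ s σ = 0} where
  toFun f := WithLp.toLp 2 fun σ => ∑ i, ∑ j, (f σ - f (sliceSwap s i j σ))
  map_add' f g := by
    ext σ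
    simp only [PiLp.add_apply, ← Finset.sum_add_distrib]
    exact Finset.sum_congr rfl fun i _ => Finset.sum_congr rfl fun j _ => by ring
  map_smul' a f := by
    ext σ
    simp only [PiLp.smul_apply, RingHom.id_apply, smul_eq_mul, Finset.mul_sum, mul_sub]

/-- The restriction of functions on the cube to a slice. -/
noncomputable def sliceRestrict (s : ℝ) :
    ((ι → Bool) → ℝ) →ₗ[ℝ]
      EuclideanSpace ℝ {σ : ι → Bool // sliceForm Finset.univ s σ = 0} where
  toFun f := WithLp.toLp 2 fun σ => f σ
  map_add' _ _ := rfl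
  map_smul' _ _ := rfl

theorem sliceLaplacian_apply (s : ℝ)
    (f : EuclideanSpace ℝ {σ : ι → Bool // sliceForm Finset.univ s σ = 0})
    (σ : {σ : ι → Bool // sliceForm Finset.univ s σ = 0}) :
    sliceLaplacian s f σ = ∑ i, ∑ j, (f σ - f (sliceSwap s i j σ)) := rfl

theorem sliceRestrict_apply {κ : Type*} [Fintype κ] (s : ℝ) (f : (κ → Bool) → ℝ)
    (σ : {σ : κ → Bool // sliceForm Finset.univ s σ = 0}) : sliceRestrict s f σ = f σ := rfl

theorem sliceLaplacian_isSymmetric (s : ℝ) :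
    (sliceLaplacian s : EuclideanSpace ℝ {σ : ι → Bool // sliceForm Finset.univ s σ = 0} →ₗ[ℝ]
      _).IsSymmetric := by
  intro f g
  simp only [PiLp.inner_apply, sliceLaplacian_apply, RCLike.inner_apply, conj_trivial,
    Finset.mul_sum, Finset.sum_mul]
  rw [Finset.sum_comm, Finset.sum_comm (s := Finset.univ
    (α := {σ : ι → Bool // sliceForm Finset.univ s σ = 0}))]
  refine Finset.sum_congr rfl fun i _ => ?_
  rw [Finset.sum_comm, Finset.sum_comm (s := Finset.univ
    (α := {σ : ι → Bool // sliceForm Finset.univ s σ = 0}))]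
  refine Finset.sum_congr rfl fun j _ => ?_
  simp only [mul_sub, sub_mul, Finset.sum_sub_distrib]
  congr 1
  refine Fintype.sum_equiv (sliceSwap s i j) _ _ fun σ => ?_
  rw [sliceSwap_sliceSwap]

/-- The spectral upper bound for the swap Laplacian on functions of low degree. -/
theorem sum_sq_sub_swap_le (s : ℝ) {m : ℕ} {f : (ι → Bool) → ℝ}
    (hf : f ∈ lowDeg Finset.univ (m + 1)) :
    ∑ i, ∑ j, ∑ σ : {σ : ι → Bool // sliceForm Finset.univ s σ = 0},
        (f σ - f (σ.1 ∘ Equiv.swap i j)) ^ 2 ≤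
      4 * m * Fintype.card ι *
        ∑ σ : {σ : ι → Bool // sliceForm Finset.univ s σ = 0}, f σ ^ 2 := by
  have hbound := inner_map_self_le_of_triangular (sliceLaplacian_isSymmetric (ι := ι) s)
    (V := fun m => (lowDeg Finset.univ m).map (sliceRestrict s))
    (lam := fun m => 2 * m * (Fintype.card ι - m + 1)) (M := m + 1)
    (C := 2 * m * Fintype.card ι)
    (fun m => Submodule.map_mono (lowDeg_mono subset_rfl (Nat.le_succ m)))
    (by simp [lowDeg])
    (by
      intro l hl
      have hlm : (l : ℝ) ≤ m := by exact_mod_cast Nat.lt_succ_iff.1 hl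
      rcases Nat.eq_zero_or_pos l with rfl | hpos
      · simp only [Nat.cast_zero, mul_zero, zero_mul]; positivity
      · have h1 : (1 : ℝ) ≤ l := by exact_mod_cast hpos
        have h2 : (0 : ℝ) ≤ Fintype.card ι := by positivity
        have h3 : (l : ℝ) * (Fintype.card ι - l + 1) ≤ l * Fintype.card ι :=
          mul_le_mul_of_nonneg_left (by linarith) (by linarith)
        have h4 := mul_le_mul_of_nonneg_right hlm h2
        linarith)
    (by
      rintro l _ ⟨f, hf, rfl⟩
      obtain ⟨g, hg, hfg⟩ := exists_swapLaplacian_sub_eqOn_slice s hf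
      refine ⟨g, hg, ?_⟩
      ext σ
      have := hfg σ σ.2
      rw [swapLaplacian_apply] at this
      exact this.symm)
    (m + 1) le_rfl (sliceRestrict s f) ⟨f, hf, rfl⟩
  have hinner : ∑ i, ∑ j, ∑ σ : {σ : ι → Bool // sliceForm Finset.univ s σ = 0},
        (f σ - f (σ.1 ∘ Equiv.swap i j)) ^ 2 =
      2 * inner ℝ (sliceLaplacian s (sliceRestrict s f)) (sliceRestrict s f) := by
    simp only [PiLp.inner_apply, sliceLaplacian_apply, sliceRestrict_apply, RCLike.inner_apply,
      conj_trivial, Finset.mul_sum]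
    rw [Finset.sum_comm (s := Finset.univ
      (α := {σ : ι → Bool // sliceForm Finset.univ s σ = 0}))]
    refine Finset.sum_congr rfl fun i _ => ?_
    rw [Finset.sum_comm (s := Finset.univ
      (α := {σ : ι → Bool // sliceForm Finset.univ s σ = 0}))]
    refine Finset.sum_congr rfl fun j _ => ?_
    have h1 : ∑ σ : {σ : ι → Bool // sliceForm Finset.univ s σ = 0}, f σ ^ 2 =
        ∑ σ : {σ : ι → Bool // sliceForm Finset.univ s σ = 0}, f (sliceSwap s i j σ) ^ 2 :=
      (Equiv.sum_comp (sliceSwap s i j)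
        (fun σ : {σ : ι → Bool // sliceForm Finset.univ s σ = 0} => f σ ^ 2)).symm
    rw [← sub_eq_zero, ← Finset.sum_sub_distrib]
    rw [← sub_eq_zero, ← Finset.sum_sub_distrib] at h1
    refine neg_eq_zero.1 (Eq.trans ?_ h1)
    rw [← Finset.sum_neg_distrib]
    refine Finset.sum_congr rfl fun σ _ => ?_
    rw [sliceSwap_coe]
    ring
  have hnorm : ‖sliceRestrict s f‖ ^ 2 =
      ∑ σ : {σ : ι → Bool // sliceForm Finset.univ s σ = 0}, f σ ^ 2 := by
    rw [EuclideanSpace.norm_sq_eq]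
    refine Finset.sum_congr rfl fun σ _ => ?_
    simp [sliceRestrict_apply]
  rw [hinner, ← hnorm]
  linarith

end Laplacian

section Coefficients

variable {ι : Type*}

theorem exists_coeff_of_mem_lowDeg [Fintype ι] {U : Finset ι} {m : ℕ}
    {f : (ι → Bool) → ℝ} (hf : f ∈ lowDeg U m) :
    ∃ c : Finset ι → ℝ, (∀ S, c S ≠ 0 → S ⊆ U ∧ S.card < m) ∧
      ∀ σ, f σ = ∑ S, c S * chi S σ := by
  classical
  refine lowDeg_induction (P := fun f => ∃ c : Finset ι → ℝ,
    (∀ S, c S ≠ 0 → S ⊆ U ∧ S.card < m) ∧ ∀ σ, f σ = ∑ S, c S * chi S σ) ?_ ?_ ?_ ?_ hf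
  · intro S hS hm
    refine ⟨Pi.single S 1, fun T hT => ?_, fun σ => ?_⟩
    · have : T = S := by
        by_contra h
        exact hT (by simp [h])
      exact this ▸ ⟨hS, hm⟩
    · simp [Pi.single_apply]
  · exact ⟨0, by simp, by simp⟩
  · rintro f₁ f₂ ⟨c₁, h₁, e₁⟩ ⟨c₂, h₂, e₂⟩
    refine ⟨c₁ + c₂, fun S hS => ?_, fun σ => ?_⟩
    · by_cases h : c₁ S = 0
      · exact h₂ S fun h' => hS (by simp [h, h'])
      · exact h₁ S h
    · simp [e₁, e₂, add_mul, Finset.sum_add_distrib]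
  · rintro a f ⟨c, h, e⟩
    refine ⟨a • c, fun S hS => h S fun h' => hS (by simp [h']), fun σ => ?_⟩
    simp [e, Finset.mul_sum, mul_assoc]

theorem sum_chi_mul_chi [Fintype ι] [DecidableEq ι] {S T : Finset ι} (h : S ≠ T) :
    ∑ σ, chi S σ * chi T σ = 0 := by
  let w : ι → Bool → ℝ := fun i b => (if i ∈ S then (if b then (1 : ℝ) else -1) else 1) *
    (if i ∈ T then (if b then (1 : ℝ) else -1) else 1)
  have h1 : ∀ σ : ι → Bool, chi S σ * chi T σ = ∏ i, w i (σ i) := by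
    intro σ
    simp only [w]
    rw [Finset.prod_mul_distrib, Finset.prod_ite_mem, Finset.prod_ite_mem]
    simp [chi]
  obtain ⟨i, hi⟩ : (symmDiff S T).Nonempty := Finset.symmDiff_nonempty.2 h
  have h4 : ∏ i, ∑ b, w i b = ∑ σ : ι → Bool, ∏ i, w i (σ i) := Fintype.prod_sum w
  rw [Fintype.sum_congr _ _ h1, ← h4]
  refine Finset.prod_eq_zero (Finset.mem_univ i) ?_
  rcases Finset.mem_symmDiff.1 hi with ⟨h2, h3⟩ | ⟨h2, h3⟩ <;> simp [w, h2, h3]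

theorem coeff_eq_zero [Fintype ι] [DecidableEq ι] {c : Finset ι → ℝ}
    (h : ∀ σ, ∑ S, c S * chi S σ = 0) (T : Finset ι) : c T = 0 := by
  have h1 : ∑ σ, (∑ S, c S * chi S σ) * chi T σ = 0 := by simp [h]
  simp_rw [Finset.sum_mul, mul_assoc] at h1
  rw [Finset.sum_comm] at h1
  simp_rw [← Finset.mul_sum] at h1
  rw [Finset.sum_eq_single T (fun S _ hS => by rw [sum_chi_mul_chi hS, mul_zero]) (by simp)] at h1
  refine (mul_eq_zero.1 h1).resolve_right (ne_of_gt (Finset.sum_pos (fun σ _ => ?_)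
    ⟨fun _ => true, by simp⟩))
  refine mul_self_pos.2 (Finset.prod_ne_zero_iff.2 fun i _ => ?_)
  split_ifs <;> simp

end Coefficients

section FinSlice

variable {n : ℕ}

theorem evalML_signs (c : Finset (Fin n) → ℝ) (σ : Fin n → Bool) :
    evalML c (signs σ) = ∑ S, c S * chi S σ := rfl

theorem evalML_mulSum (h : Finset (Fin n) → ℝ) (σ : Fin n → Bool) :
    ∑ T, mulSum h T * chi T σ = (∑ i, chi {i} σ) * ∑ S, h S * chi S σ := by
  simp_rw [mulSum, Finset.sum_mul]
  rw [Finset.sum_comm]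
  refine Finset.sum_congr rfl fun i _ => ?_
  rw [Finset.mul_sum]
  have hinv : Function.Involutive fun T : Finset (Fin n) => symmDiff T {i} := fun T =>
    symmDiff_symmDiff_cancel_right _ _
  refine Fintype.sum_equiv hinv.toPerm _ _ fun T => ?_
  have := congrFun (chi_mul_chi_singleton (symmDiff T {i}) i) σ
  rw [symmDiff_symmDiff_cancel_right, Pi.mul_apply] at this
  rw [← this]
  simp only [Function.Involutive.coe_toPerm]
  have hsq : chi {i} σ * chi {i} σ = 1 := by
    rw [chi_singleton_apply]; split_ifs <;> norm_num
  ring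

theorem mem_cardSet_iff (k : ℕ) (σ : Fin n → Bool) :
    σ ∈ cardSet n k ↔
      sliceForm Finset.univ (((Finset.univ : Finset (Fin n)).card : ℝ) - 2 * k) σ = 0 := by
  rw [cardSet, Finset.mem_filter, sliceForm_apply, sub_eq_zero, intSum, ← Int.cast_inj (α := ℝ)]
  simp

theorem cardSet_eq_image (k : ℕ) :
    cardSet n k = (Finset.univ.powersetCard k).image indicatorPoint := by
  ext σ
  rw [mem_cardSet_iff, Finset.mem_image]
  have hσ : indicatorPoint (Finset.univ.filter fun l => σ l = false) = σ := by
    ext l; simp [indicatorPoint]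
  constructor
  · intro h
    refine ⟨Finset.univ.filter fun l => σ l = false, ?_, hσ⟩
    rw [← hσ, sliceForm_indicatorPoint (Finset.subset_univ _)] at h
    refine Finset.mem_powersetCard.2 ⟨Finset.subset_univ _, ?_⟩
    have : ((Finset.univ.filter fun l => σ l = false).card : ℝ) = k := by linarith
    exact_mod_cast this
  · rintro ⟨A, hA, rfl⟩
    rw [sliceForm_indicatorPoint (Finset.subset_univ _), (Finset.mem_powersetCard.1 hA).2]
    ring

theorem indicatorPoint_injective {ι : Type*} [DecidableEq ι] :
    Function.Injective (indicatorPoint : Finset ι → ι → Bool) := by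
  intro A B h
  ext i
  have := congrFun h i
  simpa [indicatorPoint, not_iff_not] using this

theorem card_cardSet (k : ℕ) : (cardSet n k).card = n.choose k := by
  rw [cardSet_eq_image, Finset.card_image_of_injective _ indicatorPoint_injective]
  simp

theorem sum_sq_sub_expOver {A : Finset (Fin n → Bool)} (hA : A.Nonempty)
    (g : (Fin n → Bool) → ℝ) :
    ∑ σ ∈ A, (g σ - expOver A g) ^ 2 = A.card * varOver A g := by
  have hc : (A.card : ℝ) ≠ 0 := by exact_mod_cast hA.card_pos.ne'
  have h1 : ∑ σ ∈ A, g σ = A.card * expOver A g := by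
    rw [expOver]; field_simp
  have h2 : ∑ σ ∈ A, g σ ^ 2 = A.card * expOver A (fun σ => g σ ^ 2) := by
    rw [expOver]; field_simp
  simp_rw [sub_sq, Finset.sum_add_distrib, Finset.sum_sub_distrib, ← Finset.sum_mul,
    ← Finset.mul_sum]
  rw [h1, h2, varOver]
  simp only [Finset.sum_const, nsmul_eq_mul]
  ring

theorem mul_pow_le_choose_sub {k d : ℕ} {q : ℝ} (hq : 0 ≤ q) (hdk : d ≤ k) (hdn : d + k ≤ n)
    (h : q * n ^ 2 ≤ ((k : ℝ) - d) * ((n : ℝ) - k - d)) :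
    ∀ m ≤ d, (n.choose k : ℝ) * q ^ m ≤ (n - 2 * m).choose (k - m) := by
  intro m
  induction m with
  | zero => simp
  | succ m ih =>
    intro hm
    have ih' := ih (by omega)
    obtain ⟨a, ha⟩ : ∃ a, n = a + 2 * (m + 1) := ⟨n - 2 * (m + 1), by omega⟩
    obtain ⟨b, hb⟩ : ∃ b, k = b + (m + 1) := ⟨k - (m + 1), by omega⟩
    have h1 : n - 2 * (m + 1) = a := by omega
    have h2 : n - 2 * m = a + 1 + 1 := by omega
    have h3 : k - (m + 1) = b := by omega
    have h4 : k - m = b + 1 := by omega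
    have hba : b ≤ a := by omega
    rw [h1, h3]
    rw [h2, h4] at ih'
    have e1 := Nat.add_one_mul_choose_eq (a + 1) b
    have e2 := Nat.choose_mul_succ_eq a b
    obtain ⟨t, rfl⟩ : ∃ t, a = b + t := ⟨a - b, by omega⟩
    have e3 : b + t + 1 - b = t + 1 := by omega
    rw [e3] at e2
    have e1' : ((b + t + 1 + 1 : ℕ) : ℝ) * ((b + t + 1).choose b : ℝ) =
        ((b + t + 1 + 1).choose (b + 1) : ℝ) * ((b + 1 : ℕ) : ℝ) := by exact_mod_cast e1
    have e2' : ((b + t).choose b : ℝ) * ((b + t + 1 : ℕ) : ℝ) =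
        ((b + t + 1).choose b : ℝ) * ((t + 1 : ℕ) : ℝ) := by exact_mod_cast e2
    set X : ℝ := ((b + t + 1 + 1).choose (b + 1) : ℝ)
    set Y : ℝ := ((b + t + 1).choose b : ℝ)
    set Z : ℝ := ((b + t).choose b : ℝ)
    have hX : 0 ≤ X := Nat.cast_nonneg _
    have hmd : ((m : ℝ) + 1) ≤ d := by exact_mod_cast hm
    have hn' : (n : ℝ) = b + t + 2 * (m + 1) := by rw [ha]; push_cast; ring
    have hk' : (k : ℝ) = b + (m + 1) := by rw [hb]; push_cast; ring
    have hkd : (0 : ℝ) ≤ (k : ℝ) - d := by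
      have : (d : ℝ) ≤ k := by exact_mod_cast hdk
      linarith
    have hnkd : (0 : ℝ) ≤ (n : ℝ) - k - d := by
      have : (d : ℝ) + k ≤ n := by exact_mod_cast hdn
      linarith
    have hb0 : (0 : ℝ) ≤ b := Nat.cast_nonneg _
    have ht0 : (0 : ℝ) ≤ t := Nat.cast_nonneg _
    have hm0 : (0 : ℝ) ≤ m := Nat.cast_nonneg _
    have hprod : ((k : ℝ) - d) * ((n : ℝ) - k - d) ≤ (b + 1) * (t + 1) := by
      refine mul_le_mul ?_ ?_ hnkd (by positivity) <;> linarith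
    have hn2 : ((b : ℝ) + t + 2) * (b + t + 1) ≤ n ^ 2 := by
      rw [sq]
      refine mul_le_mul ?_ ?_ (by positivity) (by positivity) <;> linarith
    have hqq : q * (((b : ℝ) + t + 2) * (b + t + 1)) ≤ (b + 1) * (t + 1) :=
      (mul_le_mul_of_nonneg_left hn2 hq).trans (h.trans hprod)
    have hZ : Z * (((b : ℝ) + t + 2) * (b + t + 1)) = X * ((b + 1) * (t + 1)) := by
      push_cast at e1' e2'
      linear_combination ((b : ℝ) + t + 2) * e2' + (t + 1 : ℝ) * e1'
    have hXq : X * q ≤ Z := by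
      have hpos : (0 : ℝ) < ((b : ℝ) + t + 2) * (b + t + 1) := by positivity
      refine le_of_mul_le_mul_right ?_ hpos
      rw [hZ, mul_assoc]
      exact mul_le_mul_of_nonneg_left hqq hX
    calc (n.choose k : ℝ) * q ^ (m + 1) = (n.choose k : ℝ) * q ^ m * q := by ring
      _ ≤ X * q := mul_le_mul_of_nonneg_right ih' hq
      _ ≤ Z := hXq

theorem evalML_mem_lowDeg {d : ℕ} {c : Finset (Fin n) → ℝ} (hc : ∀ S, d < S.card → c S = 0) :
    (fun σ => evalML c (signs σ)) ∈ lowDeg Finset.univ (d + 1) := by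
  have : (fun σ => evalML c (signs σ)) = ∑ S, c S • chi S := by
    ext σ
    simp [evalML_signs]
  rw [this]
  refine Submodule.sum_mem _ fun S _ => ?_
  by_cases h : d < S.card
  · simp [hc S h]
  · exact Submodule.smul_mem _ _ (chi_mem_lowDeg (Finset.subset_univ _) (by omega))

theorem exists_int_mul_eq_evalML {γ : ℝ} {c : Finset (Fin n) → ℝ}
    (hc : ∀ S, ∃ m : ℤ, c S = m * γ) (σ : Fin n → Bool) :
    ∃ m : ℤ, evalML c (signs σ) = m * γ := by
  choose m hm using hc
  refine ⟨∑ S, m S * ∏ i ∈ S, if σ i then 1 else -1, ?_⟩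
  push_cast
  rw [evalML_signs, Finset.sum_mul]
  refine Finset.sum_congr rfl fun S _ => ?_
  rw [hm, chi]
  ring

/-- The multilinear polynomial can be rewritten, modulo the defining equation of the slice,
without the variables of a set whose transpositions fix it on the slice. -/
theorem exists_mulSum_sub_coeff_eq_zero {d k : ℕ} (hd : 1 ≤ d) (hdk : d ≤ k) (hdn : d + k ≤ n)
    {c : Finset (Fin n) → ℝ} (hc : ∀ S, d < S.card → c S = 0) {A : Finset (Fin n)}
    (hA : ∀ i ∈ A, ∀ j ∈ A, ∀ σ ∈ cardSet n k,
      evalML c (signs (σ ∘ Equiv.swap i j)) = evalML c (signs σ)) :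
    ∃ h : Finset (Fin n) → ℝ, (∀ S, d - 1 < S.card → h S = 0) ∧
      ∀ T, c T - (mulSum h T - ((n : ℝ) - 2 * k) * h T) ≠ 0 → Disjoint T A := by
  obtain ⟨g, hg, f, hf, hfg⟩ := exists_lowDeg_sdiff_of_slice_invariant d Finset.univ k hdk
    (by simpa using hdn) _ (evalML_mem_lowDeg hc) A (Finset.subset_univ A)
    (fun i hi j hj σ hσ => hA i hi j hj σ ((mem_cardSet_iff k σ).2 hσ))
  obtain ⟨h, hh, hfh⟩ := exists_coeff_of_mem_lowDeg hf
  obtain ⟨e, he, hge⟩ := exists_coeff_of_mem_lowDeg hg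
  refine ⟨h, fun S hS => ?_, fun T hT => ?_⟩
  · by_contra h0
    have := (hh S h0).2
    omega
  · have hcoeff : c T - (mulSum h T - ((n : ℝ) - 2 * k) * h T) - e T = 0 := by
      refine coeff_eq_zero
        (c := fun T => c T - (mulSum h T - ((n : ℝ) - 2 * k) * h T) - e T) (fun σ => ?_) T
      simp_rw [sub_mul, Finset.sum_sub_distrib, mul_assoc, ← Finset.mul_sum]
      have h1 := congrFun hfg σ
      rw [LinearMap.mulLeft_apply, Pi.mul_apply, Pi.sub_apply, evalML_signs, sliceForm_apply, hfh,
        hge] at h1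
      rw [evalML_mulSum, Fintype.sum_congr _ _ fun i => chi_singleton_apply i σ]
      simp only [Finset.card_univ, Fintype.card_fin] at h1
      linarith
    rw [sub_eq_zero] at hcoeff
    rw [hcoeff] at hT
    exact Finset.disjoint_of_subset_left (he T hT).1 Finset.sdiff_disjoint

theorem mul_choose_le_sum_sq_sub_swap {d k : ℕ} (hdk : d ≤ k) (hdn : d + k ≤ n) {γ : ℝ}
    {c : Finset (Fin n) → ℝ} (hc : ∀ S, d < S.card → c S = 0)
    (hint : ∀ S, ∃ m : ℤ, c S = m * γ) {i j : Fin n}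
    (hij : ∃ σ ∈ cardSet n k, evalML c (signs (σ ∘ Equiv.swap i j)) ≠ evalML c (signs σ)) :
    γ ^ 2 * (n - 2 * d).choose (k - d) ≤ ∑ σ ∈ cardSet n k,
      (evalML c (signs σ) - evalML c (signs (σ ∘ Equiv.swap i j))) ^ 2 := by
  set F : (Fin n → Bool) → ℝ := fun σ => evalML c (signs σ) with hF
  set D : (Fin n → Bool) → ℝ := F - permute (Equiv.swap i j) F with hD
  have hDmem : D ∈ lowDeg Finset.univ (d + 1) :=
    Submodule.sub_mem _ (evalML_mem_lowDeg hc) (permute_mem_lowDeg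
      (map_swap_of_mem (Finset.mem_univ i) (Finset.mem_univ j)) (evalML_mem_lowDeg hc))
  have hcount := choose_le_card_filter_ne_zero d Finset.univ k hdk (by simpa using hdn) D hDmem (by
    obtain ⟨σ, hσ, hne⟩ := hij
    rw [cardSet_eq_image, Finset.mem_image] at hσ
    obtain ⟨A, hA, rfl⟩ := hσ
    exact ⟨A, hA, sub_ne_zero.2 hne.symm⟩)
  rw [Finset.card_univ, Fintype.card_fin] at hcount
  have hval : ∀ σ, D σ ≠ 0 → γ ^ 2 ≤ D σ ^ 2 := by
    intro σ hσ
    obtain ⟨a, ha⟩ := exists_int_mul_eq_evalML hint σ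
    obtain ⟨b, hb⟩ := exists_int_mul_eq_evalML hint (σ ∘ Equiv.swap i j)
    have h1 : D σ = ((a - b : ℤ) : ℝ) * γ := by
      rw [hD, Pi.sub_apply, permute_apply, hF]
      simp only [ha, hb]
      push_cast; ring
    have h2 : a - b ≠ 0 := fun h0 => hσ (by rw [h1, h0]; simp)
    have h3 : (1 : ℝ) ≤ ((a - b : ℤ) : ℝ) ^ 2 := by
      have : 0 < (a - b) ^ 2 := by positivity
      exact_mod_cast this
    rw [h1, mul_pow]
    exact le_mul_of_one_le_left (sq_nonneg _) h3
  have hsum : ∑ σ ∈ cardSet n k,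
      (evalML c (signs σ) - evalML c (signs (σ ∘ Equiv.swap i j))) ^ 2 =
      ∑ A ∈ Finset.univ.powersetCard k, D (indicatorPoint A) ^ 2 := by
    rw [cardSet_eq_image, Finset.sum_image indicatorPoint_injective.injOn]
    rfl
  rw [hsum]
  calc γ ^ 2 * ((n - 2 * d).choose (k - d) : ℝ)
      ≤ γ ^ 2 *
          (((Finset.univ.powersetCard k).filter fun A => D (indicatorPoint A) ≠ 0).card : ℝ) :=
        mul_le_mul_of_nonneg_left (by exact_mod_cast hcount) (sq_nonneg _)
    _ = ∑ A ∈ (Finset.univ.powersetCard k).filter fun A => D (indicatorPoint A) ≠ 0, γ ^ 2 := by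
        rw [Finset.sum_const, nsmul_eq_mul, mul_comm]
    _ ≤ ∑ A ∈ (Finset.univ.powersetCard k).filter fun A => D (indicatorPoint A) ≠ 0,
          D (indicatorPoint A) ^ 2 :=
        Finset.sum_le_sum fun A hA => hval _ (Finset.mem_filter.1 hA).2
    _ ≤ _ := Finset.sum_le_sum_of_subset_of_nonneg (Finset.filter_subset _ _)
        fun _ _ _ => sq_nonneg _

theorem sum_sq_sub_swap_le_varOver {d k : ℕ} (hkn : k ≤ n) {c : Finset (Fin n) → ℝ}
    (hc : ∀ S, d < S.card → c S = 0) :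
    ∑ i, ∑ j, ∑ σ ∈ cardSet n k,
      (evalML c (signs σ) - evalML c (signs (σ ∘ Equiv.swap i j))) ^ 2 ≤
      4 * d * n * (n.choose k * varOver (cardSet n k) fun σ => evalML c (signs σ)) := by
  set F : (Fin n → Bool) → ℝ := fun σ => evalML c (signs σ) with hF
  set μ := expOver (cardSet n k) F
  have hne : (cardSet n k).Nonempty := by
    rw [← Finset.card_pos, card_cardSet]; exact Nat.choose_pos hkn
  have hmem : F - μ • chi ∅ ∈ lowDeg (Finset.univ : Finset (Fin n)) (d + 1) :=
    Submodule.sub_mem _ (evalML_mem_lowDeg hc)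
      (Submodule.smul_mem _ _ (chi_mem_lowDeg (Finset.empty_subset _) (by simp)))
  have hbound := sum_sq_sub_swap_le
    (((Finset.univ : Finset (Fin n)).card : ℝ) - 2 * k) hmem
  have hsub : ∀ G : (Fin n → Bool) → ℝ, ∑ σ ∈ cardSet n k, G σ =
      ∑ σ : {σ : Fin n → Bool //
        sliceForm Finset.univ (((Finset.univ : Finset (Fin n)).card : ℝ) - 2 * k) σ = 0}, G σ :=
    fun G => Finset.sum_subtype _ (mem_cardSet_iff k) G
  rw [← card_cardSet, ← sum_sq_sub_expOver hne]
  simp_rw [hsub]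
  simp only [chi_empty, Pi.sub_apply, Pi.smul_apply, Pi.one_apply, smul_eq_mul, mul_one,
    sub_sub_sub_cancel_right, Fintype.card_fin] at hbound
  exact hbound

theorem varOver_nonneg {A : Finset (Fin n → Bool)} (hA : A.Nonempty)
    (g : (Fin n → Bool) → ℝ) : 0 ≤ varOver A g := by
  have h1 : (0 : ℝ) < A.card := by exact_mod_cast hA.card_pos
  have h2 : 0 ≤ A.card * varOver A g := by
    rw [← sum_sq_sub_expOver hA]; exact Finset.sum_nonneg fun _ _ => sq_nonneg _
  exact nonneg_of_mul_nonneg_right h2 h1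

theorem comp_swap_mem_cardSet {k : ℕ} {σ : Fin n → Bool} (hσ : σ ∈ cardSet n k) (i j : Fin n) :
    σ ∘ Equiv.swap i j ∈ cardSet n k := by
  rw [mem_cardSet_iff] at hσ ⊢
  exact (sliceSwap _ i j ⟨σ, hσ⟩).2

theorem swap_invariant_trans {k : ℕ} {F : (Fin n → Bool) → ℝ} {i j l : Fin n}
    (hj : ∀ σ ∈ cardSet n k, F (σ ∘ Equiv.swap i j) = F σ)
    (hl : ∀ σ ∈ cardSet n k, F (σ ∘ Equiv.swap i l) = F σ) :
    ∀ σ ∈ cardSet n k, F (σ ∘ Equiv.swap j l) = F σ := by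
  intro σ hσ
  rcases eq_or_ne j l with rfl | hjl
  · rw [Equiv.swap_self]; rfl
  rcases eq_or_ne i j with rfl | hij
  · exact hl σ hσ
  rcases eq_or_ne i l with rfl | hil
  · rw [Equiv.swap_comm]; exact hj σ hσ
  have h1 : Equiv.swap j l = Equiv.swap i j * Equiv.swap i l * Equiv.swap i j := by
    rw [Equiv.swap_comm i j, Equiv.swap_comm i l, Equiv.swap_comm j l]
    ext x
    simp only [Equiv.Perm.mul_apply, Equiv.swap_apply_def]
    split_ifs <;> simp_all
  have h2 : σ ∘ Equiv.swap j l =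
      ((σ ∘ Equiv.swap i j) ∘ Equiv.swap i l) ∘ Equiv.swap i j := by
    rw [h1]; rfl
  rw [h2, hj _ (comp_swap_mem_cardSet (comp_swap_mem_cardSet hσ i j) i l),
    hl _ (comp_swap_mem_cardSet hσ i j), hj σ hσ]

/-- Some coordinate can be exchanged on the slice with all but few others. -/
theorem exists_card_not_swap_invariant_le {d k : ℕ} (hn : 0 < n) (hdk : d ≤ k) (hdn : d + k ≤ n)
    {γ : ℝ} {c : Finset (Fin n) → ℝ} (hc : ∀ S, d < S.card → c S = 0)
    (hint : ∀ S, ∃ m : ℤ, c S = m * γ) :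
    ∃ (i : Fin n) (A : Finset (Fin n)),
      (∀ j ∈ A, ∀ σ ∈ cardSet n k,
        evalML c (signs (σ ∘ Equiv.swap i j)) = evalML c (signs σ)) ∧
      (Aᶜ.card : ℝ) * (γ ^ 2 * (n - 2 * d).choose (k - d)) ≤
        4 * d * (n.choose k * varOver (cardSet n k) fun σ => evalML c (signs σ)) := by
  classical
  let good : Fin n → Finset (Fin n) := fun i => Finset.univ.filter fun j => ∀ σ ∈ cardSet n k,
    evalML c (signs (σ ∘ Equiv.swap i j)) = evalML c (signs σ)
  have hrow : ∀ i, ((good i)ᶜ.card : ℝ) * (γ ^ 2 * (n - 2 * d).choose (k - d)) ≤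
      ∑ j, ∑ σ ∈ cardSet n k,
        (evalML c (signs σ) - evalML c (signs (σ ∘ Equiv.swap i j))) ^ 2 := by
    intro i
    rw [← nsmul_eq_mul, ← Finset.sum_const]
    refine (Finset.sum_le_sum fun j hj => ?_).trans (Finset.sum_le_sum_of_subset_of_nonneg
      (Finset.subset_univ _) fun _ _ _ => Finset.sum_nonneg fun _ _ => sq_nonneg _)
    refine mul_choose_le_sum_sq_sub_swap hdk hdn hc hint ?_
    simpa [good] using hj
  have hne : (Finset.univ : Finset (Fin n)).Nonempty := ⟨⟨0, hn⟩, Finset.mem_univ _⟩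
  obtain ⟨i, -, hi⟩ := Finset.exists_le_of_sum_le hne
    (f := fun i => ((good i)ᶜ.card : ℝ) * (γ ^ 2 * (n - 2 * d).choose (k - d)))
    (g := fun _ => 4 * d * (n.choose k * varOver (cardSet n k) fun σ => evalML c (signs σ))) (by
      refine (Finset.sum_le_sum fun i _ => hrow i).trans
        ((sum_sq_sub_swap_le_varOver (by omega) hc).trans (le_of_eq ?_))
      rw [Finset.sum_const, nsmul_eq_mul, Finset.card_univ, Fintype.card_fin]
      ring)
  exact ⟨i, good i, fun j hj => (Finset.mem_filter.1 hj).2, hi⟩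

end FinSlice

theorem stmt19 (d : ℕ) (hd : 1 ≤ d) (p₀ : ℝ) (hp₀ : 0 < p₀) (hp₀' : p₀ ≤ 1 / 2)
    (γ : ℝ) (hγ : 0 < γ) :
    ∃ n₀ : ℕ, ∀ n : ℕ, n₀ ≤ n →
      ∀ p : ℝ, p₀ ≤ p → p < 1 / 2 → ∀ k : ℕ, (k : ℝ) = p * n →
      ∀ c : Finset (Fin n) → ℝ, (∀ S, d < S.card → c S = 0) →
        (∀ S, ∃ m : ℤ, c S = m * γ) →
        varOver (cardSet n k) (fun σ => evalML c (signs σ)) < Real.sqrt n →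
        ∃ h : Finset (Fin n) → ℝ, (∀ S, d - 1 < S.card → h S = 0) ∧
          ({i : Fin n | ∃ T : Finset (Fin n), i ∈ T ∧
              c T - (mulSum h T - (1 - 2 * p) * n * h T) ≠ 0}.ncard : ℝ) ≤
            (20 * (d : ℝ) ^ 2 * 7 ^ d * (Nat.factorial d : ℝ) ^ (2 * d ^ 2) /
                (2 * p) ^ (4 * d)) *
              varOver (cardSet n k) (fun σ => evalML c (signs σ)) / γ ^ 2 := by
  refine ⟨⌈14 * d / (3 * p₀)⌉₊, fun n hn p hp hp' k hk c hc hint _ => ?_⟩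
  have hp0 : 0 < p := hp₀.trans_le hp
  have hd1 : (1 : ℝ) ≤ d := by exact_mod_cast hd
  have hn1 : 14 * d ≤ 3 * p * n := by
    have h1 : 14 * d / (3 * p₀) ≤ (n : ℝ) := (Nat.le_ceil _).trans (by exact_mod_cast hn)
    rw [div_le_iff₀ (by positivity)] at h1
    have h2 : (n : ℝ) * (3 * p₀) ≤ n * (3 * p) :=
      mul_le_mul_of_nonneg_left (by linarith) (Nat.cast_nonneg _)
    linarith
  have hdk : d ≤ k := by
    have : (d : ℝ) ≤ k := by rw [hk]; nlinarith
    exact_mod_cast this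
  have hn0 : 0 < n := by
    rcases Nat.eq_zero_or_pos n with rfl | h
    · simp at hn1; linarith
    · exact h
  have hn0' : (0 : ℝ) < n := by exact_mod_cast hn0
  have hkn : k + k ≤ n := by
    have : (k : ℝ) + k ≤ n := by rw [hk]; nlinarith
    exact_mod_cast this
  obtain ⟨i, A, hA, hcard⟩ := exists_card_not_swap_invariant_le hn0 hdk (by omega) hc hint
  obtain ⟨h, hh, hact⟩ := exists_mulSum_sub_coeff_eq_zero hd hdk (by omega) hc (A := A)
    fun j hj l hl => swap_invariant_trans (F := fun σ => evalML c (signs σ)) (hA j hj) (hA l hl)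
  have hs : (1 - 2 * p) * n = (n : ℝ) - 2 * k := by rw [hk]; ring
  refine ⟨h, hh, ?_⟩
  rw [hs]
  set V := varOver (cardSet n k) (fun σ => evalML c (signs σ)) with hV
  have hV0 : 0 ≤ V := varOver_nonneg (by
    rw [← Finset.card_pos, card_cardSet]; exact Nat.choose_pos (by omega)) _
  have hncard : ({i : Fin n | ∃ T : Finset (Fin n), i ∈ T ∧
      c T - (mulSum h T - ((n : ℝ) - 2 * k) * h T) ≠ 0}.ncard : ℝ) ≤ Aᶜ.card := by
    rw [← Set.ncard_coe_finset]
    refine Nat.cast_le.2 (Set.ncard_le_ncard ?_ (Finset.finite_toSet _))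
    rintro j ⟨T, hjT, hT⟩
    simpa using Finset.disjoint_left.1 (hact T hT) hjT
  have hq := mul_pow_le_choose_sub (q := 2 * p / 7) (by positivity) hdk (by omega : d + k ≤ n) (by
    rw [hk]
    have h1 : 14 * d * (n : ℝ) ≤ 3 * p * n * n := mul_le_mul_of_nonneg_right hn1 hn0'.le
    have h2 : p * p * ((n : ℝ) * n) ≤ p * (1 / 2) * (n * n) :=
      mul_le_mul_of_nonneg_right (mul_le_mul_of_nonneg_left hp'.le hp0.le) (by positivity)
    nlinarith [sq_nonneg (d : ℝ)]) d le_rfl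
  have hN : (0 : ℝ) < n.choose k := by exact_mod_cast Nat.choose_pos (by omega)
  have hbad : (Aᶜ.card : ℝ) * (γ ^ 2 * (2 * p / 7) ^ d) ≤ 4 * d * V := by
    refine le_of_mul_le_mul_right ?_ hN
    have h1 : (Aᶜ.card : ℝ) * γ ^ 2 * (n.choose k * (2 * p / 7) ^ d) ≤
        (Aᶜ.card : ℝ) * γ ^ 2 * (n - 2 * d).choose (k - d) :=
      mul_le_mul_of_nonneg_left hq (by positivity)
    linarith
  have hconst : 4 * d * (7 ^ d / (2 * p) ^ d) ≤
      20 * (d : ℝ) ^ 2 * 7 ^ d * (Nat.factorial d : ℝ) ^ (2 * d ^ 2) / (2 * p) ^ (4 * d) := by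
    have h1 : (2 * p) ^ (4 * d) ≤ (2 * p) ^ d :=
      pow_le_pow_of_le_one (by positivity) (by linarith) (by omega)
    have h2 : (1 : ℝ) ≤ (Nat.factorial d : ℝ) ^ (2 * d ^ 2) :=
      one_le_pow₀ (by exact_mod_cast Nat.factorial_pos d)
    rw [← mul_div_assoc]
    refine div_le_div₀ (by positivity) ?_ (by positivity) h1
    calc 4 * (d : ℝ) * 7 ^ d ≤ 20 * (d : ℝ) ^ 2 * 7 ^ d :=
          mul_le_mul_of_nonneg_right (by nlinarith) (by positivity)
      _ ≤ _ := le_mul_of_one_le_right (by positivity) h2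
  refine hncard.trans ?_
  rw [le_div_iff₀ (by positivity)]
  refine le_trans ?_ (mul_le_mul_of_nonneg_right hconst hV0)
  have hpow : (0 : ℝ) < (2 * p) ^ d := by positivity
  rw [div_pow] at hbad
  have h7 : (0 : ℝ) < 7 ^ d := by positivity
  calc (Aᶜ.card : ℝ) * γ ^ 2
      = (Aᶜ.card : ℝ) * (γ ^ 2 * ((2 * p) ^ d / 7 ^ d)) * (7 ^ d / (2 * p) ^ d) := by
        field_simp
    _ ≤ 4 * d * V * (7 ^ d / (2 * p) ^ d) := mul_le_mul_of_nonneg_right hbad (by positivity)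
    _ = 4 * d * (7 ^ d / (2 * p) ^ d) * V := by ring
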